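/- Direct-parameterization policy gradient formula: fix a transition kernel p and a policy π ∈ Π. Then the extended return map has partial derivative, at π and for every pair (s,a), ∂J_ρ(π,p)/∂π_{sa} = (1/(1−γ)) · d^{π,p}_ρ(s) · q^{π,p}_{sa}. -/

import Mathlib

open scoped BigOperators

noncomputable section

namespace RMDPStmt

variable {S A : ℕ}

/-- `p` is a transition kernel: each `p s a` lies in the probability simplex `Δ^S`. -/
def IsKernel (p : Fin S → Fin A → Fin S → ℝ) : Prop :=
  ∀ s a, p s a ∈ stdSimplex ℝ (Fin S)

/-- `π` is a stationary randomized policy: each `π s` lies in the simplex `Δ^A`. -/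
def IsPolicy (π : Fin S → Fin A → ℝ) : Prop :=
  ∀ s, π s ∈ stdSimplex ℝ (Fin A)

/-- The state-to-state matrix `P^π`. -/
def Pmat (π : Fin S → Fin A → ℝ) (p : Fin S → Fin A → Fin S → ℝ) :
    Matrix (Fin S) (Fin S) ℝ :=
  Matrix.of fun s s' => ∑ a, π s a * p s a s'

/-- The expected one-step cost vector `c^π`. -/
def cvec (c : Fin S → Fin A → Fin S → ℝ) (π : Fin S → Fin A → ℝ)
    (p : Fin S → Fin A → Fin S → ℝ) : Fin S → ℝ :=
  fun s => ∑ a, π s a * ∑ s', p s a s' * c s a s'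

/-- Value function `v^{π,p}` as a discounted series. -/
def value (γ : ℝ) (c : Fin S → Fin A → Fin S → ℝ) (π : Fin S → Fin A → ℝ)
    (p : Fin S → Fin A → Fin S → ℝ) : Fin S → ℝ :=
  fun s => ∑' t : ℕ, γ ^ t * ((Pmat π p ^ t).mulVec (cvec c π p)) s

/-- The return `J_ρ(π,p)`. -/
def J (γ : ℝ) (c : Fin S → Fin A → Fin S → ℝ) (ρ : Fin S → ℝ)
    (π : Fin S → Fin A → ℝ) (p : Fin S → Fin A → Fin S → ℝ) : ℝ :=
  ∑ s, ρ s * value γ c π p s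

/-- The action-value function `q^{π,p}`. -/
def qval (γ : ℝ) (c : Fin S → Fin A → Fin S → ℝ) (π : Fin S → Fin A → ℝ)
    (p : Fin S → Fin A → Fin S → ℝ) : Fin S → Fin A → ℝ :=
  fun s a => ∑ s', p s a s' * (c s a s' + γ * value γ c π p s')

/-- The discounted state occupancy measure `d^{π,p}_ρ`. -/
def occ (γ : ℝ) (ρ : Fin S → ℝ) (π : Fin S → Fin A → ℝ)
    (p : Fin S → Fin A → Fin S → ℝ) : Fin S → ℝ :=
  fun s' => (1 - γ) * ∑' t : ℕ, γ ^ t * ∑ s, ρ s * (Pmat π p ^ t) s s'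

/-- Bregman divergence generated by `h`. -/
def breg {E : Type*} [NormedAddCommGroup E] [NormedSpace ℝ E]
    (h : E → ℝ) (x y : E) : ℝ :=
  h x - h y - fderiv ℝ h y (x - y)

/-- Weighted Bregman divergence `B_μ`. -/
def bregW {E : Type*} [NormedAddCommGroup E] [NormedSpace ℝ E]
    (μ : Fin S → ℝ) (h : E → ℝ) (x y : Fin S → E) : ℝ :=
  ∑ s, μ s * breg h (x s) (y s)

/-- Inner product of two action-indexed vectors. -/
def dotA (u v : Fin A → ℝ) : ℝ := ∑ a, u a * v a

/-- Inner product of two action-by-state arrays. -/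
def dotAS (u v : Fin A → Fin S → ℝ) : ℝ := ∑ a, ∑ s', u a s' * v a s'

/-- The robust objective `Φ(π) = sup_{p ∈ Amb} J_ρ(π,p)`. -/
def Phi (γ : ℝ) (c : Fin S → Fin A → Fin S → ℝ) (ρ : Fin S → ℝ)
    (Amb : Set (Fin S → Fin A → Fin S → ℝ)) (π : Fin S → Fin A → ℝ) : ℝ :=
  sSup ((fun p => J γ c ρ π p) '' Amb)

/-- The distribution mismatch coefficient
`M = sup_{π ∈ Π, p ∈ Amb} max_s d^{π,p}_ρ(s)/ρ_s`. -/
def mismatch (γ : ℝ) (ρ : Fin S → ℝ)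
    (Amb : Set (Fin S → Fin A → Fin S → ℝ)) : ℝ :=
  sSup {x : ℝ | ∃ (π : Fin S → Fin A → ℝ) (p : Fin S → Fin A → Fin S → ℝ),
    IsPolicy π ∧ p ∈ Amb ∧ ∃ s, x = occ γ ρ π p s / ρ s}


/-- Extended return `J_ρ(π,p) = ρᵀ (I - γ P^π)⁻¹ c^π`, defined for arbitrary
arrays `π` (agrees with the series definition on policies). -/
def Jext {S A : ℕ} (γ : ℝ) (c : Fin S → Fin A → Fin S → ℝ) (ρ : Fin S → ℝ)
    (π : Fin S → Fin A → ℝ) (p : Fin S → Fin A → Fin S → ℝ) : ℝ :=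
  ∑ s, ρ s * ((1 - γ • Pmat π p)⁻¹.mulVec (cvec c π p)) s

section MatrixCalculus

open scoped Matrix Matrix.Norms.Operator

variable {n : Type*} [Fintype n]

lemma hasDerivAt_matrix {M : ℝ → Matrix n n ℝ} {M' : Matrix n n ℝ} {x : ℝ} :
    HasDerivAt M M' x ↔ ∀ i j, HasDerivAt (fun y => M y i j) (M' i j) x :=
  Iff.trans hasDerivAt_pi (forall_congr' fun _ => hasDerivAt_pi)

variable [DecidableEq n]

lemma linfty_opNorm_le_one_of_mem_rowStochastic {P : Matrix n n ℝ}
    (hP : P ∈ Matrix.rowStochastic ℝ n) : ‖P‖ ≤ 1 := by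
  rw [Matrix.linfty_opNorm_def, ← NNReal.coe_one, NNReal.coe_le_coe]
  refine Finset.sup_le fun i _ => ?_
  rw [← NNReal.coe_le_coe, NNReal.coe_sum, NNReal.coe_one,
    ← Matrix.sum_row_of_mem_rowStochastic hP i]
  refine Finset.sum_le_sum fun j _ => ?_
  rw [coe_nnnorm, Real.norm_of_nonneg (hP.1 i j)]

lemma norm_smul_lt_one_of_mem_rowStochastic {P : Matrix n n ℝ}
    (hP : P ∈ Matrix.rowStochastic ℝ n) {γ : ℝ} (hγ : γ ∈ Set.Ioo (0 : ℝ) 1) :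
    ‖γ • P‖ < 1 := by
  rw [norm_smul, Real.norm_of_nonneg hγ.1.le]
  nlinarith [linfty_opNorm_le_one_of_mem_rowStochastic hP, hγ.1, hγ.2]

lemma isUnit_one_sub_smul_of_mem_rowStochastic {P : Matrix n n ℝ}
    (hP : P ∈ Matrix.rowStochastic ℝ n) {γ : ℝ} (hγ : γ ∈ Set.Ioo (0 : ℝ) 1) :
    IsUnit (1 - γ • P) :=
  (Units.oneSub _ (norm_smul_lt_one_of_mem_rowStochastic hP hγ)).isUnit

/-- The Neumann series of the resolvent of a stochastic matrix, entry by entry. -/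
lemma hasSum_pow_mul_pow_apply_of_mem_rowStochastic {P : Matrix n n ℝ}
    (hP : P ∈ Matrix.rowStochastic ℝ n) {γ : ℝ} (hγ : γ ∈ Set.Ioo (0 : ℝ) 1) (i j : n) :
    HasSum (fun t : ℕ => γ ^ t * (P ^ t) i j) ((1 - γ • P)⁻¹ i j) := by
  have h := hasSum_geom_series_inverse _ (norm_smul_lt_one_of_mem_rowStochastic hP hγ)
  rw [← Matrix.nonsing_inv_eq_ringInverse] at h
  have h' := h.map (Matrix.entryAddMonoidHom ℝ i j) (continuous_id.matrix_elem i j)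
  convert! h' using 2 with t
  simp [smul_pow]

lemma hasDerivAt_matrix_inv_apply {M : ℝ → Matrix n n ℝ} {M' : Matrix n n ℝ} {x : ℝ}
    (hM : ∀ i j, HasDerivAt (fun y => M y i j) (M' i j) x) (hu : IsUnit (M x)) (i j : n) :
    HasDerivAt (fun y => (M y)⁻¹ i j) (-((M x)⁻¹ * M' * (M x)⁻¹) i j) x := by
  obtain ⟨u, hu⟩ := hu
  have h := hasFDerivAt_ringInverse (𝕜 := ℝ) u
  rw [hu] at h
  have h' := h.comp_hasDerivAt x (hasDerivAt_matrix.2 hM)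
  have := hasDerivAt_matrix.1 h' i j
  have e : (↑u⁻¹ : Matrix n n ℝ) = (M x)⁻¹ := by rw [← hu, Matrix.coe_units_inv]
  simpa [e, ← Matrix.nonsing_inv_eq_ringInverse] using this

/-- Derivative of the solution of a parametrized linear system, tested against `ρ`. -/
lemma hasDerivAt_sum_mul_inv_mulVec {M : ℝ → Matrix n n ℝ} {M' : Matrix n n ℝ}
    {b : ℝ → n → ℝ} {b' : n → ℝ} {x : ℝ} (ρ : n → ℝ)
    (hM : ∀ i j, HasDerivAt (fun y => M y i j) (M' i j) x)
    (hb : ∀ i, HasDerivAt (fun y => b y i) (b' i) x) (hu : IsUnit (M x)) :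
    HasDerivAt (fun y => ∑ i, ρ i * ((M y)⁻¹ *ᵥ b y) i)
      (ρ ᵥ* (M x)⁻¹ ⬝ᵥ (b' - M' *ᵥ ((M x)⁻¹ *ᵥ b x))) x := by
  have h : HasDerivAt (fun y => ∑ i, ρ i * ((M y)⁻¹ *ᵥ b y) i)
      (∑ i, ρ i * ∑ j, (-((M x)⁻¹ * M' * (M x)⁻¹) i j * b x j + (M x)⁻¹ i j * b' j)) x :=
    HasDerivAt.fun_sum fun i _ => HasDerivAt.const_mul _ <|
      HasDerivAt.fun_sum fun j _ => (hasDerivAt_matrix_inv_apply hM hu i j).mul (hb j)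
  convert! h using 1
  have e : ∀ i, ∑ j, (-((M x)⁻¹ * M' * (M x)⁻¹) i j * b x j + (M x)⁻¹ i j * b' j)
      = ((M x)⁻¹ *ᵥ (b' - M' *ᵥ ((M x)⁻¹ *ᵥ b x))) i := by
    intro i
    rw [Matrix.mulVec_sub, Matrix.mulVec_mulVec, Matrix.mulVec_mulVec]
    simp [Finset.sum_add_distrib, Matrix.mulVec, dotProduct]
    ring
  simp_rw [e]
  exact (Matrix.dotProduct_mulVec _ _ _).symm

end MatrixCalculus

section Resolvent

open scoped Matrix

variable {γ : ℝ} {c : Fin S → Fin A → Fin S → ℝ} {ρ : Fin S → ℝ}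
  {π : Fin S → Fin A → ℝ} {p : Fin S → Fin A → Fin S → ℝ}

lemma Pmat_mem_rowStochastic (hπ : IsPolicy π) (hp : IsKernel p) :
    Pmat π p ∈ Matrix.rowStochastic ℝ (Fin S) := by
  rw [Matrix.mem_rowStochastic_iff_sum]
  simp only [Pmat, Matrix.of_apply]
  refine ⟨fun s s' => Finset.sum_nonneg fun a _ => mul_nonneg ((hπ s).1 a) ((hp s a).1 s'),
    fun s => ?_⟩
  rw [Finset.sum_comm]
  simp [← Finset.mul_sum, (hp s _).2, (hπ s).2]

lemma value_eq_inv_mulVec (hγ : γ ∈ Set.Ioo (0 : ℝ) 1) (hπ : IsPolicy π) (hp : IsKernel p) :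
    value γ c π p = (1 - γ • Pmat π p)⁻¹ *ᵥ cvec c π p := by
  ext s
  refine HasSum.tsum_eq ?_
  have h := hasSum_sum (s := Finset.univ) fun j _ =>
    (hasSum_pow_mul_pow_apply_of_mem_rowStochastic (Pmat_mem_rowStochastic hπ hp) hγ s j).mul_right
      (cvec c π p j)
  simpa only [Matrix.mulVec, dotProduct, Finset.mul_sum, mul_assoc] using h

lemma occ_eq_vecMul_inv (hγ : γ ∈ Set.Ioo (0 : ℝ) 1) (hπ : IsPolicy π) (hp : IsKernel p)
    (s : Fin S) : occ γ ρ π p s = (1 - γ) * (ρ ᵥ* (1 - γ • Pmat π p)⁻¹) s := by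
  refine congrArg ((1 - γ) * ·) (HasSum.tsum_eq ?_)
  have h := hasSum_sum (s := Finset.univ) fun i _ =>
    (hasSum_pow_mul_pow_apply_of_mem_rowStochastic (Pmat_mem_rowStochastic hπ hp) hγ i s).mul_left
      (ρ i)
  simpa only [Matrix.vecMul, dotProduct, Finset.mul_sum, mul_left_comm] using h

lemma hasDerivAt_sum_update_mul (π : Fin S → Fin A → ℝ) (f : Fin A → ℝ) (s i : Fin S) (a : Fin A)
    (x : ℝ) :
    HasDerivAt (fun y : ℝ => ∑ b, (if i = s ∧ b = a then y else π i b) * f b)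
      (if i = s then f a else 0) x := by
  have h : HasDerivAt (fun y : ℝ => ∑ b, (if i = s ∧ b = a then y else π i b) * f b)
      (∑ b, (if i = s ∧ b = a then 1 else 0) * f b) x := by
    refine HasDerivAt.fun_sum fun b _ => HasDerivAt.mul_const ?_ _
    split_ifs
    exacts [hasDerivAt_id x, hasDerivAt_const x _]
  convert! h using 1
  by_cases hi : i = s <;> simp [hi]

end Resolvent

/-- Direct-parameterization policy gradient formula:
`∂J_ρ(π,p)/∂π_{sa} = (1/(1−γ)) d^{π,p}_ρ(s) q^{π,p}_{sa}`. -/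
theorem return_partial_derivative_in_policy
    {S A : ℕ} (hS : 0 < S) (hA : 0 < A)
    (γ : ℝ) (hγ : γ ∈ Set.Ioo (0 : ℝ) 1)
    (c : Fin S → Fin A → Fin S → ℝ)
    (hc : ∀ s a s', c s a s' ∈ Set.Icc (0 : ℝ) 1)
    (ρ : Fin S → ℝ) (hρ : ρ ∈ stdSimplex ℝ (Fin S))
    (π : Fin S → Fin A → ℝ) (hπ : IsPolicy π)
    (p : Fin S → Fin A → Fin S → ℝ) (hp : IsKernel p) :
    ∀ s a, HasDerivAt
      (fun x : ℝ => Jext γ c ρ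
        (fun s1 a1 => if s1 = s ∧ a1 = a then x else π s1 a1) p)
      (1 / (1 - γ) * occ γ ρ π p s * qval γ c π p s a)
      (π s a) := by
  intro s a
  have hupd : (fun s1 a1 => if s1 = s ∧ a1 = a then π s a else π s1 a1) = π := by
    ext s1 a1
    split_ifs with h
    · rw [h.1, h.2]
    · rfl
  have hu := isUnit_one_sub_smul_of_mem_rowStochastic (Pmat_mem_rowStochastic hπ hp) hγ
  have h := hasDerivAt_sum_mul_inv_mulVec
    (M := fun x => 1 - γ • Pmat (fun s1 a1 => if s1 = s ∧ a1 = a then x else π s1 a1) p)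
    (M' := Matrix.of fun i j => -(γ * if i = s then p s a j else 0))
    (b := fun x => cvec c (fun s1 a1 => if s1 = s ∧ a1 = a then x else π s1 a1) p)
    (b' := fun i => if i = s then ∑ j, p s a j * c s a j else 0)
    (x := π s a) ρ
    (fun i j => by
      have h := ((hasDerivAt_sum_update_mul π (fun b => p i b j) s i a (π s a)).const_mul
        γ).const_sub ((1 : Matrix (Fin S) (Fin S) ℝ) i j)
      convert! h using 1
      by_cases hi : i = s <;> simp [hi])
    (fun i => by
      have h := hasDerivAt_sum_update_mul π (fun b => ∑ j, p i b j * c i b j) s i a (π s a)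
      convert! h using 1
      by_cases hi : i = s <;> simp [hi])
    (by simpa only [hupd] using hu)
  simp only [hupd, ← value_eq_inv_mulVec hγ hπ hp] at h
  convert! h using 1
  rw [occ_eq_vecMul_inv hγ hπ hp, dotProduct, Finset.sum_eq_single s]
  · have hγ' : 1 - γ ≠ 0 := sub_ne_zero.2 hγ.2.ne'
    rw [← mul_assoc, one_div_mul_cancel hγ', one_mul]
    simp [qval, Matrix.mulVec, dotProduct, mul_add, Finset.sum_add_distrib, mul_assoc,
      mul_left_comm]
  · intro i _ hi
    simp [hi, Matrix.mulVec, dotProduct]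
  · simp

end RMDPStmt
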